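/- Let $U_T$ and $U$ be subsets of $\mathbb{R}^p$ as in the general setting, with $U$ a cone. Assuming that for every $\delta > 0$ and sufficiently large $T$, $U \cap \overline{B_2} \subset (U_T \cap \overline{B_4})^\delta$, then for any sequence $u_n \in U$ with $0 \neq |u_n| \to 0$ and a choice of integers $T_n \to \infty$ with $(T_n-1)^{1/2} \leq |u_n|^{-1} \leq T_n^{1/2}$, one has $d(u_n, \Theta - \theta^*) = o(|u_n|)$, where $U_T = T^{1/2}(\Theta - \theta^*)$. -/

import Mathlib

open Metric Set Filter

/-- with `U_T = T^{1/2}(Θ - θ*)` and `U` a cone such that for every `δ > 0`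
and sufficiently large `T`, `U ∩ B̄₂ ⊆ (U_T ∩ B̄₄)^δ`, if `u_n ∈ U` satisfies
`0 ≠ |u_n| → 0` and `T_n → ∞` are integers with `(T_n - 1)^{1/2} ≤ |u_n|⁻¹ ≤ T_n^{1/2}`,
then `d(u_n, Θ - θ*) = o(|u_n|)`. -/
theorem infDist_to_shifted_littleO (p : ℕ) (Θ : Set (EuclideanSpace ℝ (Fin p)))
    (θs : EuclideanSpace ℝ (Fin p)) (hθs : θs ∈ Θ)
    (U : Set (EuclideanSpace ℝ (Fin p)))
    (hcone : ∀ u ∈ U, ∀ t : ℝ, 0 ≤ t → t • u ∈ U)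
    (happrox : ∀ δ > (0 : ℝ), ∃ N : ℕ, ∀ n : ℕ, N ≤ n → 1 ≤ n →
      U ∩ Metric.closedBall 0 2 ⊆
        Metric.thickening δ
          ({u : EuclideanSpace ℝ (Fin p) | θs + ((n : ℝ) ^ (-(1/2 : ℝ))) • u ∈ Θ} ∩
            Metric.closedBall 0 4))
    (u : ℕ → EuclideanSpace ℝ (Fin p))
    (huU : ∀ n, u n ∈ U) (hune : ∀ n, u n ≠ 0)
    (hu0 : Tendsto (fun n => ‖u n‖) atTop (nhds 0))
    (Tn : ℕ → ℕ) (hTn : Tendsto Tn atTop atTop)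
    (hTbound : ∀ n, Real.sqrt ((Tn n : ℝ) - 1) ≤ ‖u n‖⁻¹ ∧ ‖u n‖⁻¹ ≤ Real.sqrt (Tn n)) :
    (fun n => Metric.infDist (u n) {x : EuclideanSpace ℝ (Fin p) | θs + x ∈ Θ})
      =o[atTop] fun n => ‖u n‖ := by
  rw [Asymptotics.isLittleO_iff]
  intro c hc
  obtain ⟨N, hN⟩ := happrox c hc
  filter_upwards [hTn.eventually_ge_atTop N, hTn.eventually_ge_atTop 2] with n h1 h2
  obtain ⟨hb1, hb2⟩ := hTbound n
  have hun : 0 < ‖u n‖ := norm_pos_iff.mpr (hune n)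
  have hT : (2 : ℝ) ≤ (Tn n : ℝ) := by exact_mod_cast h2
  have hs : 0 < Real.sqrt (Tn n) := Real.sqrt_pos.mpr (by linarith)
  have hrp : ((Tn n : ℝ) ^ (-(1/2 : ℝ))) = (Real.sqrt (Tn n))⁻¹ := by
    rw [Real.rpow_neg (by linarith), Real.sqrt_eq_rpow]
  have h4 : Real.sqrt (Tn n) ≤ 2 * Real.sqrt ((Tn n : ℝ) - 1) := by
    rw [Real.sqrt_le_left (by positivity), mul_pow, Real.sq_sqrt (by linarith)]
    linarith
  have h5 : Real.sqrt (Tn n) * ‖u n‖ ≤ 2 := by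
    have h6 : Real.sqrt (Tn n) ≤ 2 * ‖u n‖⁻¹ := by linarith
    calc Real.sqrt (Tn n) * ‖u n‖ ≤ 2 * ‖u n‖⁻¹ * ‖u n‖ := by gcongr
      _ = 2 := by field_simp
  have hmem := hN (Tn n) h1 (by omega)
    (show Real.sqrt (Tn n) • u n ∈ U ∩ Metric.closedBall 0 2 from
      ⟨hcone _ (huU n) _ hs.le, by
        rw [mem_closedBall_zero_iff, norm_smul, Real.norm_of_nonneg hs.le]; exact h5⟩)
  rw [Metric.mem_thickening_iff] at hmem
  obtain ⟨v, ⟨hv, -⟩, hd⟩ := hmem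
  rw [Set.mem_setOf_eq, hrp] at hv
  rw [Real.norm_of_nonneg Metric.infDist_nonneg, norm_norm]
  have hi : (Real.sqrt (Tn n))⁻¹ ≤ ‖u n‖ := inv_le_of_inv_le₀ hun hb2
  have he : u n = (Real.sqrt (Tn n))⁻¹ • (Real.sqrt (Tn n) • u n) := by
    rw [smul_smul, inv_mul_cancel₀ hs.ne', one_smul]
  calc Metric.infDist (u n) {x : EuclideanSpace ℝ (Fin p) | θs + x ∈ Θ}
      ≤ dist (u n) ((Real.sqrt (Tn n))⁻¹ • v) := Metric.infDist_le_dist_of_mem hv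
    _ = (Real.sqrt (Tn n))⁻¹ * dist (Real.sqrt (Tn n) • u n) v := by
        conv_lhs => rw [he]
        rw [dist_smul₀, Real.norm_of_nonneg (inv_nonneg.mpr hs.le)]
    _ ≤ ‖u n‖ * c := mul_le_mul hi hd.le dist_nonneg hun.le
    _ = c * ‖u n‖ := mul_comm _ _
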